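/- arXiv:1802.07483 — 2 statements merged into one kernel-verified Lean document; each statement's English description precedes it below -/
import Mathlib

section
/- (Iterated kernel bound (3.2.4)) Let α>0, a>0 and T with a<T≤+∞. Let ψ be a nonnegative, nondecreasing continuous function on [a,T), and define the operator M on nonnegative locally integrable functions θ on [a,T) by (Mθ)(t) = ψ(t)·∫_a^t (log(t/τ))^{α-1} θ(τ)/τ dτ. Then for every k≥1 and every nonnegative locally integrable function v on [a,T), (M^k v)(t) ≤ ∫_a^t (ψ(t)Γ(α))^k/Γ(kα) · (log(t/τ))^{kα-1} · v(τ)/τ dτ for all t∈[a,T). -/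
open MeasureTheory Real Set Filter
open scoped ENNReal

/-- The kernel `log (t / τ) ^ (β - 1) / τ` on `τ < t`, extended by zero. -/
noncomputable def logKernel (β t τ : ℝ) : ℝ≥0∞ :=
  if τ < t then ENNReal.ofReal (Real.log (t / τ) ^ (β - 1) / τ) else 0

/-- The Hadamard-type fractional integral with lower limit `b`, without the factor `1 / Γ(β)`. -/
noncomputable def logIntegral (β b : ℝ) (f : ℝ → ℝ≥0∞) (t : ℝ) : ℝ≥0∞ :=
  ∫⁻ τ in Ioi b, logKernel β t τ * f τ

lemma logKernel_of_lt {β t τ : ℝ} (h : τ < t) :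
    logKernel β t τ = ENNReal.ofReal (Real.log (t / τ) ^ (β - 1) / τ) := if_pos h

lemma logKernel_of_le {β t τ : ℝ} (h : t ≤ τ) : logKernel β t τ = 0 := if_neg h.not_gt

lemma measurable_logKernel (β : ℝ) :
    Measurable fun p : ℝ × ℝ => logKernel β p.1 p.2 := by
  unfold logKernel
  exact Measurable.ite (measurableSet_lt measurable_snd measurable_fst) (by fun_prop) (by fun_prop)

lemma Measurable.logIntegral {f : ℝ → ℝ≥0∞} (hf : Measurable f) (β b : ℝ) :
    Measurable (logIntegral β b f) :=
  Measurable.lintegral_prod_right'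
    (f := fun p : ℝ × ℝ => logKernel β p.1 p.2 * f p.2)
    ((measurable_logKernel β).mul (hf.comp measurable_snd))

lemma lintegral_Ioo_rpow_mul_rpow {α β : ℝ} (hα : 0 < α) (hβ : 0 < β) :
    ∫⁻ x in Ioo (0 : ℝ) 1, ENNReal.ofReal (x ^ (α - 1) * (1 - x) ^ (β - 1)) =
      ENNReal.ofReal (ProbabilityTheory.beta α β) := by
  have hb := ProbabilityTheory.beta_pos hα hβ
  have h := ProbabilityTheory.lintegral_betaPDF_eq_one hα hβ
  rw [ProbabilityTheory.lintegral_betaPDF] at h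
  simp_rw [mul_assoc, ENNReal.ofReal_mul (one_div_pos.2 hb).le] at h
  rw [lintegral_const_mul' _ _ ENNReal.ofReal_ne_top] at h
  calc _ = ENNReal.ofReal (ProbabilityTheory.beta α β) *
        (ENNReal.ofReal (1 / ProbabilityTheory.beta α β) *
          ∫⁻ x in Ioo (0 : ℝ) 1, ENNReal.ofReal (x ^ (α - 1) * (1 - x) ^ (β - 1))) := by
        rw [← mul_assoc, ← ENNReal.ofReal_mul hb.le, mul_one_div_cancel hb.ne',
          ENNReal.ofReal_one, one_mul]
    _ = _ := by rw [h, mul_one]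

lemma image_log_div_Ioo {τ t : ℝ} (hτ : 0 < τ) (h : τ < t) :
    (fun s => Real.log (s / τ) / Real.log (t / τ)) '' Ioo τ t = Ioo 0 1 := by
  have hL : 0 < Real.log (t / τ) := Real.log_pos ((one_lt_div hτ).2 h)
  ext x
  constructor
  · rintro ⟨s, ⟨h1, h2⟩, rfl⟩
    have : 0 < s := hτ.trans h1
    exact ⟨div_pos (Real.log_pos ((one_lt_div hτ).2 h1)) hL,
      (div_lt_one hL).2 (Real.log_lt_log (by positivity) (by gcongr))⟩
  · rintro ⟨h0, h1⟩
    refine ⟨τ * Real.exp (x * Real.log (t / τ)), ⟨?_, ?_⟩, ?_⟩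
    · exact lt_mul_of_one_lt_right hτ (Real.one_lt_exp_iff.2 (by positivity))
    · have : Real.exp (x * Real.log (t / τ)) < t / τ := by
        rw [← Real.lt_log_iff_exp_lt (by have := hτ.trans h; positivity)]
        exact mul_lt_of_lt_one_left hL h1
      rwa [lt_div_iff₀' hτ] at this
    · simp only
      rw [mul_div_cancel_left₀ _ hτ.ne', Real.log_exp, mul_div_cancel_right₀ _ hL.ne']

lemma lintegral_logKernel_mul_logKernel {α β : ℝ} (hα : 0 < α) (hβ : 0 < β)
    {b τ t : ℝ} (hb : 0 < b) (hτ : b < τ) :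
    ∫⁻ s in Ioi b, logKernel α t s * logKernel β s τ =
      ENNReal.ofReal (ProbabilityTheory.beta β α) * logKernel (α + β) t τ := by
  have hτ0 : 0 < τ := hb.trans hτ
  rcases le_or_gt t τ with h | h
  · rw [logKernel_of_le h, mul_zero, ← lintegral_zero]
    refine lintegral_congr fun s => ?_
    rcases le_or_gt t s with hs | hs
    · rw [logKernel_of_le hs, zero_mul]
    · rw [logKernel_of_le (hs.le.trans h), mul_zero]
  have hL : 0 < Real.log (t / τ) := Real.log_pos ((one_lt_div hτ0).2 h)
  have hsupp : (Function.support fun s => logKernel α t s * logKernel β s τ) ⊆ Ioo τ t := by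
    intro s hs
    rw [Function.mem_support] at hs
    constructor
    · by_contra! h'
      exact hs (by rw [logKernel_of_le h', mul_zero])
    · by_contra! h'
      exact hs (by rw [logKernel_of_le h', zero_mul])
  rw [setLIntegral_eq_of_support_subset (hsupp.trans fun s hs => mem_Ioi.2 (hτ.trans hs.1)),
    ← setLIntegral_eq_of_support_subset hsupp]
  have hcv := lintegral_image_eq_lintegral_deriv_mul_of_monotoneOn
    (s := Ioo τ t) (f := fun s => Real.log (s / τ) / Real.log (t / τ))
    (f' := fun s => s⁻¹ / Real.log (t / τ)) measurableSet_Ioo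
    (fun s hs => by
      have hs0 : 0 < s := hτ0.trans hs.1
      refine ((((hasDerivAt_id s).div_const τ).log (div_pos hs0 hτ0).ne').div_const
        (Real.log (t / τ))).hasDerivWithinAt.congr_deriv ?_
      simp only [id]
      field_simp)
    (fun x hx y hy hxy => by
      have : 0 < x := hτ0.trans hx.1
      simp only
      gcongr)
    (fun x => ENNReal.ofReal (x ^ (β - 1) * (1 - x) ^ (α - 1)))
  rw [image_log_div_Ioo hτ0 h, lintegral_Ioo_rpow_mul_rpow hβ hα] at hcv
  rw [hcv, mul_comm, logKernel_of_lt h, ← lintegral_const_mul' _ _ ENNReal.ofReal_ne_top]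
  refine setLIntegral_congr_fun measurableSet_Ioo fun s hs => ?_
  have hs0 : 0 < s := hτ0.trans hs.1
  have ht0 : 0 < t := hτ0.trans h
  have h1 : 0 < Real.log (s / τ) := Real.log_pos ((one_lt_div hτ0).2 hs.1)
  have h2 : 0 < Real.log (t / s) := Real.log_pos ((one_lt_div hs0).2 hs.2)
  have h3 : 1 - Real.log (s / τ) / Real.log (t / τ) = Real.log (t / s) / Real.log (t / τ) := by
    rw [Real.log_div ht0.ne' hs0.ne', one_sub_div hL.ne', Real.log_div ht0.ne' hτ0.ne',
      Real.log_div hs0.ne' hτ0.ne']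
    ring
  rw [logKernel_of_lt hs.2, logKernel_of_lt hs.1, ← ENNReal.ofReal_mul (by positivity),
    ← ENNReal.ofReal_mul (by positivity), ← ENNReal.ofReal_mul (by positivity), h3,
    Real.div_rpow h1.le hL.le, Real.div_rpow h2.le hL.le,
    show α + β - 1 = (α - 1) + (β - 1) + 1 by ring, Real.rpow_add hL, Real.rpow_add hL,
    Real.rpow_one]
  congr 1
  field_simp

lemma logIntegral_logIntegral {α β : ℝ} (hα : 0 < α) (hβ : 0 < β) {b : ℝ} (hb : 0 < b)
    {f : ℝ → ℝ≥0∞} (hf : Measurable f) (t : ℝ) :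
    logIntegral α b (logIntegral β b f) t =
      ENNReal.ofReal (ProbabilityTheory.beta β α) * logIntegral (α + β) b f t := by
  have hm (s : ℝ) : Measurable fun τ => logKernel β s τ * f τ :=
    ((measurable_logKernel β).comp measurable_prodMk_left).mul hf
  unfold logIntegral
  simp_rw [← lintegral_const_mul _ (hm _)]
  rw [lintegral_lintegral_swap, ← lintegral_const_mul' _ _ ENNReal.ofReal_ne_top]
  · refine setLIntegral_congr_fun measurableSet_Ioi fun τ hτ => ?_
    rw [← mul_assoc, ← lintegral_logKernel_mul_logKernel hα hβ hb hτ, ← lintegral_mul_const]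
    · simp_rw [mul_assoc]
    · exact ((measurable_logKernel α).comp measurable_prodMk_left).mul
        ((measurable_logKernel β).comp measurable_prodMk_right)
  · refine Measurable.aemeasurable ?_
    exact ((measurable_logKernel α).comp (measurable_const.prodMk measurable_fst)).mul
      ((measurable_logKernel β).mul (hf.comp measurable_snd))

lemma logIntegral_mono {β b t : ℝ} {f g : ℝ → ℝ≥0∞}
    (h : ∀ s, b < s → s < t → f s ≤ g s) : logIntegral β b f t ≤ logIntegral β b g t := by
  refine setLIntegral_mono' measurableSet_Ioi fun s hs => ?_
  rcases le_or_gt t s with hs' | hs'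
  · simp [logKernel_of_le hs']
  · gcongr
    exact h s hs hs'

lemma logIntegral_const_mul {β b t : ℝ} {c : ℝ≥0∞} (hc : c ≠ ∞) (f : ℝ → ℝ≥0∞) :
    logIntegral β b (fun s => c * f s) t = c * logIntegral β b f t := by
  unfold logIntegral
  rw [← lintegral_const_mul' _ _ hc]
  simp_rw [mul_left_comm]

lemma logIntegral_anti_lower {β b b' t : ℝ} (h : b' ≤ b) (f : ℝ → ℝ≥0∞) :
    logIntegral β b f t ≤ logIntegral β b' f t :=
  lintegral_mono_set (Ioi_subset_Ioi h)

lemma logIntegral_eq_setLIntegral_Ioo (β b t : ℝ) (f : ℝ → ℝ≥0∞) :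
    logIntegral β b f t = ∫⁻ τ in Ioo b t, logKernel β t τ * f τ := by
  have : (fun τ => logKernel β t τ * f τ) =
      (Iio t).indicator fun τ => logKernel β t τ * f τ := by
    ext τ
    by_cases h : τ < t
    · rw [indicator_of_mem (by exact h)]
    · rw [indicator_of_notMem (by exact h), logKernel_of_le (not_lt.1 h), zero_mul]
  unfold logIntegral
  rw [this, setLIntegral_indicator measurableSet_Iio, Iio_inter_Ioi,
    setLIntegral_congr_fun measurableSet_Ioo fun τ hτ => indicator_of_mem (by exact hτ.2) _]

lemma logKernel_le_of_le {β a b t τ : ℝ} (ha : 0 < a) (hbt : b < t) (haτ : a < τ) (hτb : τ ≤ b) :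
    logKernel β t τ ≤ ENNReal.ofReal
      ((Real.log (t / b) ^ (β - 1) + Real.log (t / a) ^ (β - 1)) / a) := by
  have hτ : 0 < τ := ha.trans haτ
  have hb : 0 < b := hτ.trans_le hτb
  have ht : 0 < t := hb.trans hbt
  have h0 : 0 < Real.log (t / b) := Real.log_pos ((one_lt_div hb).2 hbt)
  have h1 : Real.log (t / b) ≤ Real.log (t / τ) := by gcongr
  have h2 : Real.log (t / τ) ≤ Real.log (t / a) := by gcongr
  have h3 : 0 < Real.log (t / τ) := h0.trans_le h1
  have h4 : 0 < Real.log (t / a) := h3.trans_le h2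
  rw [logKernel_of_lt (hτb.trans_lt hbt)]
  gcongr
  rcases le_total 0 (β - 1) with hβ | hβ
  · have := Real.rpow_le_rpow h3.le h2 hβ
    have := Real.rpow_nonneg h0.le (β - 1)
    linarith
  · have := Real.rpow_le_rpow_of_nonpos h0 h1 hβ
    have := Real.rpow_nonneg h4.le (β - 1)
    linarith

lemma logKernel_add_one_le {β a t τ : ℝ} (hβ : 0 < β) (ha : 0 < a) (haτ : a < τ) (hτ : τ < t) :
    logKernel (1 + β) t τ ≤ ENNReal.ofReal (Real.log (t / a) ^ β / a) := by
  have hτ0 : 0 < τ := ha.trans haτ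
  have ht : 0 < t := hτ0.trans hτ
  have h0 : 0 < Real.log (t / τ) := Real.log_pos ((one_lt_div hτ0).2 hτ)
  have h1 : Real.log (t / τ) ≤ Real.log (t / a) := by gcongr
  have h2 : 0 < Real.log (t / a) := h0.trans_le h1
  rw [logKernel_of_lt hτ, add_sub_cancel_left]
  gcongr

lemma setLIntegral_mul_ne_top {μ : Measure ℝ} {s : Set ℝ} (hs : MeasurableSet s)
    {g f : ℝ → ℝ≥0∞} {c : ℝ} (hg : ∀ x ∈ s, g x ≤ ENNReal.ofReal c)
    (hf : ∫⁻ x in s, f x ∂μ ≠ ∞) : ∫⁻ x in s, g x * f x ∂μ ≠ ∞ := by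
  refine ne_top_of_le_ne_top (ENNReal.mul_ne_top (ENNReal.ofReal_ne_top (r := c)) hf) ?_
  rw [← lintegral_const_mul' _ _ ENNReal.ofReal_ne_top]
  refine setLIntegral_mono' hs fun x hx => ?_
  gcongr
  exact hg x hx

/-- Divergence of the fractional integral at `t` only depends on the function near `t`. -/
lemma logIntegral_eq_top_of_lower_lt {β a b t : ℝ} (ha : 0 < a) (hab : a ≤ b) (hbt : b < t)
    {f : ℝ → ℝ≥0∞} (hf : ∫⁻ τ in Ioc a t, f τ ≠ ∞) (h : logIntegral β a f t = ∞) :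
    logIntegral β b f t = ∞ := by
  by_contra hfin
  unfold logIntegral at h hfin
  rw [← Ioc_union_Ioi_eq_Ioi hab] at h
  refine ENNReal.add_ne_top.2 ⟨?_, hfin⟩ (top_le_iff.1 (h.symm.le.trans (lintegral_union_le _ _ _)))
  exact setLIntegral_mul_ne_top measurableSet_Ioc
    (fun τ hτ => logKernel_le_of_le ha hbt hτ.1 hτ.2)
    (ne_top_of_le_ne_top hf (lintegral_mono_set (Ioc_subset_Ioc_right hbt.le)))

lemma ae_logIntegral_lt_top {β a t : ℝ} (hβ : 0 < β) (ha : 0 < a)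
    {f : ℝ → ℝ≥0∞} (hm : Measurable f) (hf : ∫⁻ τ in Ioc a t, f τ ≠ ∞) :
    ∀ᵐ s ∂volume.restrict (Ioc a t), logIntegral β a f s < ∞ := by
  have h1 : logIntegral 1 a (logIntegral β a f) t ≠ ∞ := by
    rw [logIntegral_logIntegral one_pos hβ ha hm]
    refine ENNReal.mul_ne_top ENNReal.ofReal_ne_top ?_
    rw [logIntegral_eq_setLIntegral_Ioo]
    exact setLIntegral_mul_ne_top measurableSet_Ioo
      (fun τ hτ => logKernel_add_one_le hβ ha hτ.1 hτ.2)
      (ne_top_of_le_ne_top hf (lintegral_mono_set Ioo_subset_Ioc_self))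
  rw [logIntegral_eq_setLIntegral_Ioo] at h1
  rw [← Measure.restrict_congr_set (Ioo_ae_eq_Ioc (a := a) (b := t))]
  have h2 := ae_lt_top (((measurable_logKernel 1).comp measurable_prodMk_left).mul
    (hm.logIntegral β a)) h1
  filter_upwards [h2, ae_restrict_mem measurableSet_Ioo] with s hs hst
  refine lt_top_iff_ne_top.2 fun htop => hs.ne ?_
  have hs0 : 0 < s := ha.trans hst.1
  simp only [Pi.mul_apply, Function.comp_apply]
  rw [htop, ENNReal.mul_top]
  rw [logKernel_of_lt hst.2]
  simpa using hs0

/-- The Bochner form of the fractional integral; both sides vanish where it diverges. -/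
lemma setIntegral_log_eq_toReal_logIntegral {β a t : ℝ} (ha : 0 < a)
    {f : ℝ → ℝ≥0∞} (hm : Measurable f) (hf : ∀ᵐ s ∂volume.restrict (Ioc a t), f s < ∞)
    {θ : ℝ → ℝ} (hθ : θ =ᵐ[volume.restrict (Ioc a t)] fun s => (f s).toReal) :
    ∫ τ in Ioc a t, Real.log (t / τ) ^ (β - 1) * θ τ / τ = (logIntegral β a f t).toReal := by
  rw [← Measure.restrict_congr_set (Ioo_ae_eq_Ioc (a := a) (b := t))] at hf hθ
  rw [integral_Ioc_eq_integral_Ioo, logIntegral_eq_setLIntegral_Ioo, ← integral_toReal]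
  · refine integral_congr_ae ?_
    filter_upwards [hθ, ae_restrict_mem measurableSet_Ioo] with s hs hst
    have hs0 : 0 < s := ha.trans hst.1
    have h0 : 0 < Real.log (t / s) := Real.log_pos ((one_lt_div hs0).2 hst.2)
    rw [hs, logKernel_of_lt hst.2, ENNReal.toReal_mul, ENNReal.toReal_ofReal (by positivity)]
    ring
  · exact (((measurable_logKernel β).comp measurable_prodMk_left).mul hm).aemeasurable
  · filter_upwards [hf, ae_restrict_mem measurableSet_Ioo] with s hs hst
    rw [logKernel_of_lt hst.2]
    exact ENNReal.mul_lt_top ENNReal.ofReal_lt_top hs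

/-- The operator `f ↦ p · logIntegral α a f`. -/
noncomputable def weightedLogIntegral (p : ℝ → ℝ≥0∞) (α a : ℝ) (f : ℝ → ℝ≥0∞) (t : ℝ) : ℝ≥0∞ :=
  p t * logIntegral α a f t

lemma measurable_iterate_weightedLogIntegral {p f : ℝ → ℝ≥0∞} (hp : Measurable p)
    (hf : Measurable f) (α a : ℝ) (k : ℕ) : Measurable ((weightedLogIntegral p α a)^[k] f) := by
  induction k with
  | zero => exact hf
  | succ k ih =>
    rw [Function.iterate_succ_apply']
    exact hp.mul (ih.logIntegral α a)

lemma logIntegral_iterate_const {α a : ℝ} (hα : 0 < α) (ha : 0 < a) {f : ℝ → ℝ≥0∞}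
    (hf : Measurable f) {c : ℝ≥0∞} (hc : c ≠ ∞) {k : ℕ} (hk : 1 ≤ k) (t : ℝ) :
    c * logIntegral α a (fun s => c ^ k * ENNReal.ofReal (Real.Gamma α ^ k / Real.Gamma (k * α)) *
      logIntegral (k * α) a f s) t =
    c ^ (k + 1) * ENNReal.ofReal
      (Real.Gamma α ^ (k + 1) / Real.Gamma ((k + 1 : ℕ) * α)) *
        logIntegral ((k + 1 : ℕ) * α) a f t := by
  have hkα : 0 < (k : ℝ) * α := by positivity
  have hΓ := Real.Gamma_pos_of_pos hα
  have hΓk := Real.Gamma_pos_of_pos hkα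
  rw [logIntegral_const_mul (ENNReal.mul_ne_top (ENNReal.pow_ne_top hc) ENNReal.ofReal_ne_top),
    logIntegral_logIntegral hα hkα ha hf,
    show α + (k : ℝ) * α = ((k + 1 : ℕ) : ℝ) * α by push_cast; ring,
    show Real.Gamma α ^ (k + 1) / Real.Gamma ((k + 1 : ℕ) * α) =
      Real.Gamma α ^ k / Real.Gamma (k * α) * ProbabilityTheory.beta (k * α) α by
        rw [ProbabilityTheory.beta,
          show (k : ℝ) * α + α = ((k + 1 : ℕ) : ℝ) * α by push_cast; ring]
        field_simp
        ring,
    ENNReal.ofReal_mul (by positivity)]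
  ring

lemma iterate_weightedLogIntegral_le {α a : ℝ} (hα : 0 < α) (ha : 0 < a) {p f : ℝ → ℝ≥0∞}
    (hp : Monotone p) (hp_top : ∀ s, p s ≠ ∞) (hf : Measurable f) {k : ℕ} (hk : 1 ≤ k) (t : ℝ) :
    (weightedLogIntegral p α a)^[k] f t ≤
      p t ^ k * ENNReal.ofReal (Real.Gamma α ^ k / Real.Gamma (k * α)) *
        logIntegral (k * α) a f t := by
  induction k, hk using Nat.le_induction generalizing t with
  | base => simp [weightedLogIntegral, (Real.Gamma_pos_of_pos hα).ne']
  | succ k hk ih =>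
    rw [Function.iterate_succ_apply', weightedLogIntegral,
      ← logIntegral_iterate_const hα ha hf (hp_top t) hk]
    gcongr
    refine logIntegral_mono fun s _ hst => (ih s).trans ?_
    gcongr
    exact hp hst.le

lemma le_iterate_weightedLogIntegral {α a b t₀ : ℝ} (hα : 0 < α) (ha : 0 < a) (hab : a ≤ b)
    {p f : ℝ → ℝ≥0∞} {c : ℝ≥0∞} (hc : c ≠ ∞) (hp : ∀ s ∈ Ioc b t₀, c ≤ p s)
    (hf : Measurable f) {k : ℕ} (hk : 1 ≤ k) {t : ℝ} (ht : t ∈ Ioc b t₀) :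
    c ^ k * ENNReal.ofReal (Real.Gamma α ^ k / Real.Gamma (k * α)) * logIntegral (k * α) b f t ≤
      (weightedLogIntegral p α a)^[k] f t := by
  induction k, hk using Nat.le_induction generalizing t with
  | base =>
    simp only [weightedLogIntegral, pow_one, Nat.cast_one, one_mul, Function.iterate_one,
      div_self (Real.Gamma_pos_of_pos hα).ne', ENNReal.ofReal_one, mul_one]
    exact mul_le_mul' (hp t ht) (logIntegral_anti_lower hab f)
  | succ k hk ih =>
    rw [Function.iterate_succ_apply', weightedLogIntegral,
      ← logIntegral_iterate_const hα (ha.trans_le hab) hf hc hk]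
    refine mul_le_mul' (hp t ht) (le_trans ?_ (logIntegral_anti_lower hab _))
    exact logIntegral_mono fun s hbs hst => ih ⟨hbs, hst.le.trans ht.2⟩

lemma iterate_weightedLogIntegral_eq_top {α a t : ℝ} (hα : 0 < α) (ha : 0 < a) (hat : a < t)
    {p f : ℝ → ℝ≥0∞} (hp : ContinuousAt p t) (hp_top : p t ≠ ∞) (hp_zero : p t ≠ 0)
    (hm : Measurable f) (hf : ∫⁻ τ in Ioc a t, f τ ≠ ∞) {k : ℕ} (hk : 1 ≤ k)
    (h : logIntegral (k * α) a f t = ∞) : (weightedLogIntegral p α a)^[k] f t = ∞ := by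
  have hlt : p t / 2 < p t := ENNReal.half_lt_self hp_zero hp_top
  obtain ⟨l, hl, hlp⟩ := exists_Ioc_subset_of_mem_nhds (hp.eventually_const_lt hlt) ⟨a, hat⟩
  have hlt' : max a l < t := max_lt hat hl
  have hΓ := Real.Gamma_pos_of_pos hα
  have hΓk := Real.Gamma_pos_of_pos (show 0 < (k : ℝ) * α by positivity)
  have hle := le_iterate_weightedLogIntegral hα ha (le_max_left a l) (t₀ := t)
    (ENNReal.div_ne_top hp_top two_ne_zero)
    (fun s hs => (hlp ⟨(le_max_right a l).trans_lt hs.1, hs.2⟩ : p t / 2 < p s).le) hm hk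
    (right_mem_Ioc.2 hlt')
  rw [logIntegral_eq_top_of_lower_lt ha (le_max_left a l) hlt' hf h, ENNReal.mul_top] at hle
  · exact top_le_iff.1 hle
  · refine mul_ne_zero (pow_ne_zero _ (ENNReal.div_ne_zero.2 ⟨hp_zero, by simp⟩)) ?_
    rw [Ne, ENNReal.ofReal_eq_zero, not_le]
    positivity

lemma ae_iterate_weightedLogIntegral_lt_top {α a t : ℝ} (hα : 0 < α) (ha : 0 < a)
    {p f : ℝ → ℝ≥0∞} (hp : Monotone p) (hp_top : ∀ s, p s ≠ ∞)
    (hm : Measurable f) (hf : ∫⁻ τ in Ioc a t, f τ ≠ ∞) (k : ℕ) :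
    ∀ᵐ s ∂volume.restrict (Ioc a t), (weightedLogIntegral p α a)^[k] f s < ∞ := by
  rcases Nat.eq_zero_or_pos k with rfl | hk
  · exact ae_lt_top hm hf
  · filter_upwards [ae_logIntegral_lt_top (β := k * α) (by positivity) ha hm hf] with s hs
    exact (iterate_weightedLogIntegral_le hα ha hp hp_top hm hk s).trans_lt
      (ENNReal.mul_lt_top (ENNReal.mul_lt_top (ENNReal.pow_lt_top (hp_top s).lt_top)
        ENNReal.ofReal_lt_top) hs)

lemma iterate_eq_toReal_iterate_weightedLogIntegral {α a t : ℝ} (hα : 0 < α) (ha : 0 < a)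
    {p f : ℝ → ℝ≥0∞} (hp : Monotone p) (hp_top : ∀ s, p s ≠ ∞)
    (hm : Measurable f) (hf : ∫⁻ τ in Ioc a t, f τ ≠ ∞)
    {ψ v : ℝ → ℝ} (hψ : ∀ s ∈ Icc a t, ψ s = (p s).toReal)
    (hv : v =ᵐ[volume.restrict (Ioc a t)] fun s => (f s).toReal)
    {M : (ℝ → ℝ) → ℝ → ℝ}
    (hM : ∀ θ s, M θ s = ψ s * ∫ τ in Ioc a s, Real.log (s / τ) ^ (α - 1) * θ τ / τ)
    {k : ℕ} (hk : 1 ≤ k) {s : ℝ} (hs : s ∈ Icc a t) :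
    M^[k] v s = ((weightedLogIntegral p α a)^[k] f s).toReal := by
  have step (j : ℕ) (hj : M^[j] v =ᵐ[volume.restrict (Ioc a t)]
      fun s => ((weightedLogIntegral p α a)^[j] f s).toReal) {s : ℝ} (hs : s ∈ Icc a t) :
      M^[j + 1] v s = ((weightedLogIntegral p α a)^[j + 1] f s).toReal := by
    have hsub : Ioc a s ⊆ Ioc a t := Ioc_subset_Ioc_right hs.2
    rw [Function.iterate_succ_apply', Function.iterate_succ_apply', hM, weightedLogIntegral,
      setIntegral_log_eq_toReal_logIntegral ha
        (measurable_iterate_weightedLogIntegral hp.measurable hm α a j)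
        (ae_restrict_of_ae_restrict_of_subset hsub
          (ae_iterate_weightedLogIntegral_lt_top hα ha hp hp_top hm hf j))
        (ae_restrict_of_ae_restrict_of_subset hsub hj), ENNReal.toReal_mul, hψ s hs]
  induction k, hk using Nat.le_induction generalizing s with
  | base => exact step 0 hv hs
  | succ k hk ih =>
    refine step k ?_ hs
    filter_upwards [ae_restrict_mem measurableSet_Ioc] with r hr
    exact ih (Ioc_subset_Icc_self hr)

theorem iterated_kernel_bound
    (α a : ℝ) (T : EReal) (hα : 0 < α) (ha : 0 < a) (haT : (a : EReal) < T)
    (ψ : ℝ → ℝ)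
    (hψ_nonneg : ∀ t, a ≤ t → (t : EReal) < T → 0 ≤ ψ t)
    (hψ_mono : MonotoneOn ψ {t : ℝ | a ≤ t ∧ (t : EReal) < T})
    (hψ_cont : ContinuousOn ψ {t : ℝ | a ≤ t ∧ (t : EReal) < T})
    (M : (ℝ → ℝ) → (ℝ → ℝ))
    (hM : ∀ θ : ℝ → ℝ, ∀ t : ℝ,
      M θ t = ψ t * ∫ τ in Set.Ioc a t, (Real.log (t / τ)) ^ (α - 1) * θ τ / τ)
    (v : ℝ → ℝ)
    (hv_nonneg : ∀ t, a ≤ t → (t : EReal) < T → 0 ≤ v t)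
    (hv_int : ∀ t, a ≤ t → (t : EReal) < T → IntegrableOn v (Set.Icc a t)) :
    ∀ k : ℕ, 1 ≤ k → ∀ t, a ≤ t → (t : EReal) < T →
      M^[k] v t ≤ ∫ τ in Set.Ioc a t,
        (ψ t * Real.Gamma α) ^ k / Real.Gamma ((k : ℝ) * α) *
          (Real.log (t / τ)) ^ ((k : ℝ) * α - 1) * v τ / τ := by
  intro k hk t hat htT
  rcases hat.eq_or_lt with rfl | hat'
  · obtain ⟨j, rfl⟩ := Nat.exists_eq_add_of_le' hk
    rw [Function.iterate_succ_apply', hM]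
    simp
  have hΓ := Real.Gamma_pos_of_pos hα
  have hΓk := Real.Gamma_pos_of_pos (show 0 < (k : ℝ) * α by positivity)
  have hlt {s : ℝ} (hs : s ≤ t) : (s : EReal) < T := (EReal.coe_le_coe_iff.2 hs).trans_lt htT
  have hclamp (s : ℝ) : max a (min s t) ∈ {t : ℝ | a ≤ t ∧ (t : EReal) < T} :=
    ⟨le_max_left _ _, hlt (max_le hat (min_le_right _ _))⟩
  set p : ℝ → ℝ≥0∞ := fun s => ENNReal.ofReal (ψ (max a (min s t))) with hp_def
  have hp : Monotone p := fun x y hxy =>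
    ENNReal.ofReal_le_ofReal (hψ_mono (hclamp x) (hclamp y) (by gcongr))
  have hp_cont : Continuous p :=
    ENNReal.continuous_ofReal.comp (hψ_cont.comp_continuous (by fun_prop) hclamp)
  have hp_top (s : ℝ) : p s ≠ ∞ := ENNReal.ofReal_ne_top
  have hψp (s : ℝ) (hs : s ∈ Icc a t) : ψ s = (p s).toReal := by
    simp only [hp_def, min_eq_left hs.2, max_eq_right hs.1]
    rw [ENNReal.toReal_ofReal (hψ_nonneg s hs.1 (hlt hs.2))]
  have hv := (hv_int t hat htT).mono_set Ioc_subset_Icc_self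
  obtain ⟨f, hm, hvf⟩ := hv.aemeasurable.ennreal_ofReal
  have hf : ∫⁻ τ in Ioc a t, f τ ≠ ∞ := by
    rw [← lintegral_congr_ae hvf]
    exact hv.lintegral_lt_top.ne
  have hvf' : v =ᵐ[volume.restrict (Ioc a t)] fun s => (f s).toReal := by
    filter_upwards [hvf, ae_restrict_mem measurableSet_Ioc] with s hs hst
    rw [← hs, ENNReal.toReal_ofReal (hv_nonneg s hst.1.le (hlt hst.2))]
  rw [iterate_eq_toReal_iterate_weightedLogIntegral hα ha hp hp_top hm hf hψp hvf' hM hk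
    (right_mem_Icc.2 hat)]
  simp_rw [mul_assoc, mul_div_assoc]
  rw [integral_const_mul]
  simp_rw [← mul_div_assoc]
  rw [setIntegral_log_eq_toReal_logIntegral ha hm (ae_lt_top hm hf) hvf', mul_pow, mul_div_assoc,
    hψp t (right_mem_Icc.2 hat), ← ENNReal.toReal_pow,
    ← ENNReal.toReal_ofReal (show 0 ≤ Real.Gamma α ^ k / Real.Gamma (k * α) by positivity),
    ← ENNReal.toReal_mul, ← ENNReal.toReal_mul]
  by_cases htop : p t ^ k * ENNReal.ofReal (Real.Gamma α ^ k / Real.Gamma (k * α)) *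
      logIntegral (k * α) a f t = ∞
  · have hp_zero : p t ≠ 0 := by
      rintro h0
      simp [h0, (Nat.one_le_iff_ne_zero.1 hk)] at htop
    have hI : logIntegral (k * α) a f t = ∞ := by
      by_contra hI
      exact ENNReal.mul_ne_top (ENNReal.mul_ne_top (ENNReal.pow_ne_top (hp_top t))
        ENNReal.ofReal_ne_top) hI htop
    rw [iterate_weightedLogIntegral_eq_top hα ha hat' hp_cont.continuousAt (hp_top t) hp_zero hm
      hf hk hI, ENNReal.toReal_top]
    exact ENNReal.toReal_nonneg
  · exact ENNReal.toReal_mono htop (iterate_weightedLogIntegral_le hα ha hp hp_top hm hk t)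
end

section
/- (Vanishing of the iterated kernels) Let α>0, 0<a<t, C≥0, and let v be a nonnegative function integrable on (a,t). Then the sequence I_k := ∫_a^t (CΓ(α))^k/Γ(kα) · (log(t/τ))^{kα-1} · v(τ)/τ dτ tends to 0 as k→∞. -/
open MeasureTheory Real Set Filter

theorem rpow_mul_exp_neg_le_Gamma {M s : ℝ} (hM : 0 < M) (hs : 1 ≤ s) :
    M ^ (s - 1) * Real.exp (-M) ≤ Real.Gamma s := by
  have hG := Real.GammaIntegral_convergent (s := s) (by linarith)
  rw [Real.Gamma_eq_integral (by linarith), ← integral_exp_neg_Ioi M, ← integral_const_mul]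
  calc ∫ x in Ioi M, M ^ (s - 1) * Real.exp (-x)
      ≤ ∫ x in Ioi M, Real.exp (-x) * x ^ (s - 1) := by
        refine setIntegral_mono_on ((integrableOn_exp_neg_Ioi M).const_mul _)
          (hG.mono_set (Ioi_subset_Ioi hM.le)) measurableSet_Ioi fun x hx => ?_
        rw [mul_comm]
        exact mul_le_mul_of_nonneg_left
          (Real.rpow_le_rpow hM.le (le_of_lt hx) (by linarith)) (Real.exp_pos _).le
    _ ≤ ∫ x in Ioi 0, Real.exp (-x) * x ^ (s - 1) := by
        refine setIntegral_mono_set hG ?_ (Ioi_subset_Ioi hM.le).eventuallyLE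
        filter_upwards [ae_restrict_mem measurableSet_Ioi] with x hx
        exact mul_nonneg (Real.exp_pos _).le (Real.rpow_nonneg (le_of_lt hx) _)

theorem eventually_one_le_natCast_mul {α : ℝ} (hα : 0 < α) :
    ∀ᶠ k : ℕ in atTop, 1 ≤ (k : ℝ) * α :=
  (tendsto_natCast_atTop_atTop.atTop_mul_const hα).eventually_ge_atTop 1

theorem rpow_natCast_mul_sub_one {x : ℝ} (hx : 0 < x) (k : ℕ) (α : ℝ) :
    x ^ ((k : ℝ) * α - 1) = (x ^ α) ^ k / x := by
  rw [Real.rpow_sub_one hx.ne', mul_comm, Real.rpow_mul_natCast hx.le]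

theorem tendsto_pow_div_Gamma_natCast_mul {α : ℝ} (hα : 0 < α) (D : ℝ) :
    Tendsto (fun k : ℕ => D ^ k / Real.Gamma ((k : ℝ) * α)) atTop (nhds 0) := by
  have hD : 0 < |D| + 1 := by positivity
  set M : ℝ := (|D| + 1) ^ α⁻¹
  have hM : 0 < M := Real.rpow_pos_of_pos hD _
  have hMα : M ^ α = |D| + 1 := Real.rpow_inv_rpow hD.le hα.ne'
  have hgeom : Tendsto (fun k : ℕ => (M * Real.exp M) * (|D| / (|D| + 1)) ^ k) atTop (nhds 0) := by
    simpa using (tendsto_pow_atTop_nhds_zero_of_lt_one (r := |D| / (|D| + 1)) (by positivity)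
      ((div_lt_one hD).2 (by linarith))).const_mul (M * Real.exp M)
  refine squeeze_zero_norm' ?_ hgeom
  filter_upwards [eventually_one_le_natCast_mul hα] with k hk
  have hle := rpow_mul_exp_neg_le_Gamma hM hk
  rw [rpow_natCast_mul_sub_one hM, hMα] at hle
  rw [Real.norm_eq_abs, abs_div, abs_pow, abs_of_pos (Real.Gamma_pos_of_pos (by linarith))]
  calc |D| ^ k / Real.Gamma ((k : ℝ) * α)
      ≤ |D| ^ k / ((|D| + 1) ^ k / M * Real.exp (-M)) :=
        div_le_div_of_nonneg_left (by positivity) (by positivity) hle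
    _ = (M * Real.exp M) * (|D| / (|D| + 1)) ^ k := by
        rw [Real.exp_neg, div_pow]
        field_simp

theorem iterated_kernels_vanish
    (α a t C : ℝ) (hα : 0 < α) (ha : 0 < a) (hat : a < t) (hC : 0 ≤ C)
    (v : ℝ → ℝ) (hv_nonneg : ∀ τ ∈ Set.Ioc a t, 0 ≤ v τ)
    (hv_int : IntegrableOn v (Set.Ioc a t)) :
    Filter.Tendsto
      (fun k : ℕ => ∫ τ in Set.Ioc a t,
        (C * Real.Gamma α) ^ k / Real.Gamma ((k : ℝ) * α) *
          (Real.log (t / τ)) ^ ((k : ℝ) * α - 1) * v τ / τ)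
      Filter.atTop (nhds 0) := by
  set L := Real.log (t / a)
  have hL : 0 < L := Real.log_pos ((one_lt_div ha).2 hat)
  have hΓ := Real.Gamma_pos_of_pos hα
  have hlim := (tendsto_pow_div_Gamma_natCast_mul hα (C * Real.Gamma α * L ^ α)).mul_const
    ((∫ τ in Set.Ioc a t, v τ / a) / L)
  rw [zero_mul] at hlim
  refine squeeze_zero_norm' ?_ hlim
  filter_upwards [eventually_one_le_natCast_mul hα] with k hk
  have hΓk := Real.Gamma_pos_of_pos (zero_lt_one.trans_le hk)
  have hbound : ∀ τ ∈ Set.Ioc a t,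
      ‖(C * Real.Gamma α) ^ k / Real.Gamma ((k : ℝ) * α) *
          (Real.log (t / τ)) ^ ((k : ℝ) * α - 1) * v τ / τ‖ ≤
        (C * Real.Gamma α) ^ k / Real.Gamma ((k : ℝ) * α) * L ^ ((k : ℝ) * α - 1) * (v τ / a) := by
    intro τ hτ
    have hτ0 : 0 < τ := ha.trans hτ.1
    have hv := hv_nonneg τ hτ
    have hlog : 0 ≤ Real.log (t / τ) := Real.log_nonneg ((one_le_div hτ0).2 hτ.2)
    have hlogL : Real.log (t / τ) ≤ L :=
      Real.log_le_log (div_pos (ha.trans hat) hτ0)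
        (div_le_div_of_nonneg_left (ha.trans hat).le ha hτ.1.le)
    rw [Real.norm_of_nonneg (by positivity), mul_div_assoc]
    have hpow := Real.rpow_le_rpow hlog hlogL (sub_nonneg.2 hk)
    have hdiv := div_le_div_of_nonneg_left hv ha hτ.1.le
    gcongr
  calc ‖∫ τ in Set.Ioc a t, (C * Real.Gamma α) ^ k / Real.Gamma ((k : ℝ) * α) *
          (Real.log (t / τ)) ^ ((k : ℝ) * α - 1) * v τ / τ‖
      ≤ ∫ τ in Set.Ioc a t, (C * Real.Gamma α) ^ k / Real.Gamma ((k : ℝ) * α) *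
          L ^ ((k : ℝ) * α - 1) * (v τ / a) :=
        norm_integral_le_of_norm_le ((hv_int.div_const a).const_mul _)
          ((ae_restrict_iff' measurableSet_Ioc).2 (ae_of_all _ hbound))
    _ = (C * Real.Gamma α * L ^ α) ^ k / Real.Gamma ((k : ℝ) * α) *
          ((∫ τ in Set.Ioc a t, v τ / a) / L) := by
        rw [integral_const_mul, rpow_natCast_mul_sub_one hL, mul_pow]
        ring
end
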